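/- Let k ≥ 1 and let P₁ be a real polynomial of degree k+1; set P₂(x) = P₁(x−1) − P₁(x), a polynomial of degree k, and assume P₂(−n) ≠ 0 for all n ≥ 0. Let α ∈ ℝ. Define γ_{n+1} = P₂(−n) for n ≥ 0, λ_n = P₁(−n) for n ≥ 0, β_n = −γ_{n+1}/γ_n for n ≥ 1, and the polynomials q_0 = 1 and q_n = L_n^α + β_n·L_{n−1}^α for n ≥ 1. Let D = P₁(D_α) + (d/dx) ∘ P₂(D_α), where d/dx is the derivative operator on ℝ[X]. Then D(q_n) = λ_n·q_n for all n ≥ 0. -/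

import Mathlib

open Polynomial

/-- The Pochhammer symbol `(y)_j = y(y+1)⋯(y+j-1)` for a real `y`. -/
noncomputable def poch (y : ℝ) (j : ℕ) : ℝ := ∏ i ∈ Finset.range j, (y + i)

/-- The Laguerre polynomial `L_n^α(x) = ∑_{j=0}^n ((-x)^j/j!) binom(n+α, n-j)`,
where `binom(n+α, n-j) = (α+j+1)_{n-j}/(n-j)!`. -/
noncomputable def laguerre (α : ℝ) (n : ℕ) : ℝ[X] :=
  ∑ j ∈ Finset.range (n+1),
    C (poch (α + j + 1) (n-j) / (((n-j).factorial : ℝ) * (j.factorial : ℝ))) * (-X)^j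

theorem poch_succ_right (y : ℝ) (m : ℕ) : poch y (m + 1) = poch y m * (y + m) := by
  simp [poch, Finset.prod_range_succ]

theorem poch_succ_left (y : ℝ) (m : ℕ) : poch y (m + 1) = y * poch (y + 1) m := by
  simp only [poch, Finset.prod_range_succ']
  rw [mul_comm]
  congr 1
  · simp
  · exact Finset.prod_congr rfl fun i _ => by push_cast; ring

theorem coeff_laguerre (α : ℝ) (n j : ℕ) :
    (laguerre α n).coeff j = if j ≤ n then
      (-1) ^ j * (poch (α + j + 1) (n - j) / (((n - j).factorial : ℝ) * (j.factorial : ℝ)))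
      else 0 := by
  have neg_X_pow (i : ℕ) : (-X : ℝ[X]) ^ i = C ((-1) ^ i) * X ^ i := by
    rw [neg_pow]; simp
  simp only [laguerre, neg_X_pow, finsetSum_coeff, coeff_C_mul, coeff_X_pow, mul_ite, mul_one,
    mul_zero, Finset.sum_ite_eq, Finset.mem_range, Nat.lt_succ_iff]
  split_ifs
  · ring
  · rfl

theorem coeff_laguerre_add (α : ℝ) (j m : ℕ) :
    (laguerre α (j + m)).coeff j =
      (-1) ^ j * (poch (α + j + 1) m / ((m.factorial : ℝ) * (j.factorial : ℝ))) := by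
  simp [coeff_laguerre]

theorem coeff_laguerre_of_lt (α : ℝ) {n j : ℕ} (h : n < j) : (laguerre α n).coeff j = 0 := by
  simp [coeff_laguerre, h.not_ge]

theorem laguerre_zero (α : ℝ) : laguerre α 0 = 1 := by
  simp [laguerre, poch]

theorem coeff_laguerre_succ (α : ℝ) (n j : ℕ) :
    (j + 1) * (j + 1 + α) * (laguerre α n).coeff (j + 1) =
      -((n : ℝ) - j) * (laguerre α n).coeff j := by
  rcases lt_trichotomy n j with h | rfl | h
  · simp [coeff_laguerre_of_lt α h, coeff_laguerre_of_lt α (h.trans j.lt_succ_self)]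
  · simp [coeff_laguerre_of_lt α n.lt_succ_self]
  · obtain ⟨m, rfl⟩ := Nat.exists_eq_add_of_lt h
    have h₁ := coeff_laguerre_add α (j + 1) m
    rw [show j + 1 + m = j + m + 1 by ring] at h₁
    rw [h₁, show j + m + 1 = j + (m + 1) by ring, coeff_laguerre_add, poch_succ_left,
      Nat.factorial_succ, Nat.factorial_succ]
    push_cast
    rw [show α + (j + 1) + 1 = α + j + 1 + 1 by ring]
    field_simp
    ring

theorem laguerre_differential_equation (α : ℝ) (n : ℕ) :
    X * derivative (derivative (laguerre α n)) + (C (α + 1) - X) * derivative (laguerre α n) =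
      (-(n : ℝ)) • laguerre α n := by
  ext j
  have h := coeff_laguerre_succ α n j
  rw [sub_mul]
  rcases j with _ | j <;>
    simp only [coeff_add, coeff_sub, coeff_smul, coeff_C_mul, coeff_X_mul, coeff_X_mul_zero,
      coeff_derivative, smul_eq_mul] <;> push_cast at h ⊢ <;> linear_combination h

theorem derivative_laguerre_succ (α : ℝ) (n : ℕ) :
    derivative (laguerre α (n + 1)) = derivative (laguerre α n) - laguerre α n := by
  ext j
  rw [coeff_sub, coeff_derivative, coeff_derivative]
  rcases lt_trichotomy n j with h | rfl | h
  · simp [coeff_laguerre_of_lt α h, coeff_laguerre_of_lt α (h.trans j.lt_succ_self),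
      coeff_laguerre_of_lt α (Nat.succ_lt_succ h)]
  · have h₁ := coeff_laguerre_add α n 0
    have h₂ := coeff_laguerre_add α (n + 1) 0
    rw [add_zero] at h₁ h₂
    rw [h₁, h₂, coeff_laguerre_of_lt α n.lt_succ_self, Nat.factorial_succ]
    simp only [poch, Finset.range_zero, Finset.prod_empty, Nat.factorial_zero]
    push_cast
    field_simp
    ring
  · obtain ⟨m, rfl⟩ := Nat.exists_eq_add_of_lt h
    have h₁ := coeff_laguerre_add α (j + 1) m
    have h₂ := coeff_laguerre_add α (j + 1) (m + 1)
    have h₃ := coeff_laguerre_add α j (m + 1)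
    rw [show j + 1 + m = j + m + 1 by ring] at h₁
    rw [show j + 1 + (m + 1) = j + m + 1 + 1 by ring] at h₂
    rw [show j + (m + 1) = j + m + 1 by ring] at h₃
    rw [h₁, h₂, h₃, poch_succ_right, poch_succ_left, Nat.factorial_succ, Nat.factorial_succ]
    push_cast
    rw [show α + (j + 1) + 1 = α + j + 1 + 1 by ring]
    field_simp
    ring

/-- Theorem A.2: the polynomials `q_n = L_n^α + β_n L_{n-1}^α` are eigenfunctions of
the differential operator `D = P₁(D_α) + (d/dx) P₂(D_α)` of order `2k+2`. -/
theorem stmt18 (k : ℕ) (hk : 1 ≤ k)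
    (P₁ P₂ : ℝ[X]) (hdegP₁ : P₁.degree = (k+1 : ℕ))
    (hP₂ : P₂ = P₁.comp (X - 1) - P₁)
    (hnz : ∀ n : ℕ, P₂.eval (-(n : ℝ)) ≠ 0)
    (α : ℝ)
    (γ lam β : ℕ → ℝ)
    (hγ : ∀ n : ℕ, γ (n+1) = P₂.eval (-(n : ℝ)))
    (hlam : ∀ n : ℕ, lam n = P₁.eval (-(n : ℝ)))
    (hβ : ∀ n : ℕ, 1 ≤ n → β n = -(γ (n+1) / γ n))
    (q : ℕ → ℝ[X]) (hq0 : q 0 = 1)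
    (hq : ∀ n : ℕ, q (n+1) = laguerre α (n+1) + C (β (n+1)) * laguerre α n)
    (Dα : Module.End ℝ ℝ[X])
    (hDα : ∀ f : ℝ[X], Dα f = X * derivative (derivative f) + (C (α+1) - X) * derivative f)
    (D : Module.End ℝ ℝ[X])
    (hD : D = aeval Dα P₁ + (derivative : ℝ[X] →ₗ[ℝ] ℝ[X]) * aeval Dα P₂) :
    ∀ n : ℕ, D (q n) = lam n • q n := by
  have heig (P : ℝ[X]) (n : ℕ) :
      aeval Dα P (laguerre α n) = P.eval (-(n : ℝ)) • laguerre α n :=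
    Module.End.aeval_apply_of_mem_apply_eq_smul
      ((hDα _).trans (laguerre_differential_equation α n))
  have hDL (n : ℕ) : D (laguerre α n) =
      P₁.eval (-(n : ℝ)) • laguerre α n + P₂.eval (-(n : ℝ)) • derivative (laguerre α n) := by
    rw [hD, LinearMap.add_apply, Module.End.mul_apply, heig, heig, map_smul]
  intro n
  rcases n with _ | n
  · have h := hDL 0
    rw [laguerre_zero] at h
    rw [hq0, h, hlam]
    simp
  · have hshift : P₂.eval (-(n : ℝ)) = P₁.eval (-((n + 1 : ℕ) : ℝ)) - P₁.eval (-(n : ℝ)) := by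
      rw [hP₂, eval_sub, eval_comp, eval_sub, eval_X, eval_one]
      push_cast
      rw [neg_add']
    have hβγ : β (n + 1) * P₂.eval (-(n : ℝ)) = -P₂.eval (-((n + 1 : ℕ) : ℝ)) := by
      rw [hβ _ n.succ_pos, hγ, hγ, neg_mul, div_mul_cancel₀ _ (hnz n)]
    rw [hq, ← smul_eq_C_mul, map_add, map_smul, hDL, hDL, derivative_laguerre_succ, hlam]
    generalize P₂.eval (-((n + 1 : ℕ) : ℝ)) = b at *
    obtain rfl : b = -(β (n + 1) * P₂.eval (-(n : ℝ))) := by rw [hβγ, neg_neg]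
    rw [hshift]
    module
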